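/- The presented group on three generators x₁, x₂, x₃ with relators x₁^2, x₁*u*x₃*u⁻¹ where u = x₃⁻¹*x₂*x₁*x₂*x₁⁻¹*x₂⁻¹*x₃*x₁⁻¹, and x₂*v*x₃*v⁻¹ where v = x₁⁻¹*x₂⁻¹*x₃*x₁⁻¹*x₃⁻¹*x₂*x₁*x₂*x₁⁻¹*x₂⁻¹, is isomorphic to the Coxeter group W(3,5,∞), i.e. to the presented group on three generators x₁, x₂, x₃ with relators x₁^2, x₂^2, x₃^2, (x₁*x₂)^3 and (x₁*x₃)^5. (This is the fundamental group computation for τ_{R(D₂(12a₄₂₇))} in Remark 4.21(2).) -/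

import Mathlib

/-- The generator `x₁` of the free group on three generators. -/
def x1 : FreeGroup (Fin 3) := FreeGroup.of 0

/-- The generator `x₂` of the free group on three generators. -/
def x2 : FreeGroup (Fin 3) := FreeGroup.of 1

/-- The generator `x₃` of the free group on three generators. -/
def x3 : FreeGroup (Fin 3) := FreeGroup.of 2

/-- The relators of the Coxeter group `W(3,5,∞)`:
`x₁², x₂², x₃², (x₁x₂)³, (x₁x₃)⁵`. -/
def W35InfRels : Set (FreeGroup (Fin 3)) :=
  {x1 ^ 2, x2 ^ 2, x3 ^ 2, (x1 * x2) ^ 3, (x1 * x3) ^ 5}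

/-- The word `u = x₃⁻¹x₂x₁x₂x₁⁻¹x₂⁻¹x₃x₁⁻¹`. -/
def u : FreeGroup (Fin 3) := x3⁻¹ * x2 * x1 * x2 * x1⁻¹ * x2⁻¹ * x3 * x1⁻¹

/-- The word `v = x₁⁻¹x₂⁻¹x₃x₁⁻¹x₃⁻¹x₂x₁x₂x₁⁻¹x₂⁻¹`. -/
def v : FreeGroup (Fin 3) := x1⁻¹ * x2⁻¹ * x3 * x1⁻¹ * x3⁻¹ * x2 * x1 * x2 * x1⁻¹ * x2⁻¹

/-- The τ-presentation relators of `π₁(τ_{R(D₂(12a₄₂₇))})`. -/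
def rels18 : Set (FreeGroup (Fin 3)) :=
  {x1 ^ 2, x1 * u * x3 * u⁻¹, x2 * v * x3 * v⁻¹}

/-- If `c = wtwtw` and `tw(tct)w = 1`, then `c` conjugates `t` into `w`. -/
lemma conj_eq_of_relations {G : Type*} [Group G] {t c w : G}
    (hc : c = w * t * w * t * w) (h : t * w * (t * c * t) * w = 1) : c * t * c = w := by
  have h5 : t * w * t * w * t * w * t * w * t * w = 1 := by
    simpa only [hc, mul_assoc] using h
  calc c * t * c = w * (t * w * t * w * t * w * t * w * t * w) := by
        simp only [hc, mul_assoc]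
    _ = w := by rw [h5, mul_one]

/-- For involutions `a`, `b`, `c` of a group, the two long relators of `rels18`
force the braid relations of `W(3,5,∞)`. -/
lemma coxeter_relations_of_involutions {G : Type*} [Group G] {a b c : G}
    (ha : a * a = 1) (hb : b * b = 1) (hc : c * c = 1)
    (h₁ : a * (c * b * a * b * a * b * c * a) * c * (a * c * b * a * b * a * b * c) = 1)
    (h₂ : b * (a * b * c * a * c * b * a * b * a * b) * c *
      (b * a * b * a * b * c * a * c * b * a) = 1) :
    (a * b) ^ 3 = 1 ∧ (a * c) ^ 5 = 1 := by
  have ha' (x : G) : a * (a * x) = x := by rw [← mul_assoc, ha, one_mul]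
  have hb' (x : G) : b * (b * x) = x := by rw [← mul_assoc, hb, one_mul]
  have hc' (x : G) : c * (c * x) = x := by rw [← mul_assoc, hc, one_mul]
  obtain ⟨w, hw⟩ : ∃ w, w = b * a * b * a * b := ⟨_, rfl⟩
  obtain ⟨t, ht⟩ : ∃ t, t = c * a * c := ⟨_, rfl⟩
  have hctc : c * t * c = a := by simp [ht, mul_assoc, hc, hc']
  have hcw : c = w * t * w * t * w := by
    have key := congrArg (fun x => (a * b * c * a * c * b * a * b * a * b)⁻¹ * x *
      (a * b * c * a * c * b * a * b * a * b) * c) h₂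
    have ia : a⁻¹ = a := inv_eq_of_mul_eq_one_left ha
    have ib : b⁻¹ = b := inv_eq_of_mul_eq_one_left hb
    have ic : c⁻¹ = c := inv_eq_of_mul_eq_one_left hc
    simp only [mul_inv_rev, ia, ib, ic, mul_assoc, hb, hc, ha', hb', hc', mul_one, one_mul] at key
    simp only [hw, ht, mul_assoc]
    exact key.symm
  have hrel : t * w * (t * c * t) * w = 1 := by
    have key := congrArg (fun x => c * x * c) h₁
    simp only [mul_assoc, hc, mul_one] at key
    simpa only [hw, ht, mul_assoc, hc', mul_one] using key
  have haw : a = w := hctc.symm.trans (conj_eq_of_relations hcw hrel)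
  refine ⟨?_, ?_⟩
  · calc (a * b) ^ 3 = a * w := by simp only [hw, pow_succ, pow_zero, one_mul, mul_assoc]
      _ = 1 := by rw [← haw, ha]
  · rw [← haw, ht] at hcw
    calc (a * c) ^ 5 = (a * (c * a * c) * a * (c * a * c) * a) * c := by
          simp only [pow_succ, pow_zero, one_mul, mul_assoc]
      _ = 1 := by rw [← hcw, hc]

/-- The long relators of `rels18` hold whenever `a` is an involution and the
braid relations of `W(3,5,∞)` hold. -/
lemma relations_of_coxeter {G : Type*} [Group G] {a b c : G}
    (ha : a * a = 1) (hab : (a * b) ^ 3 = 1) (hac : (a * c) ^ 5 = 1) :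
    a * (c * b * a * b * a * b * c * a) * c * (a * c * b * a * b * a * b * c) = 1 ∧
    b * (a * b * c * a * c * b * a * b * a * b) * c *
      (b * a * b * a * b * c * a * c * b * a) = 1 := by
  have ha' (x : G) : a * (a * x) = x := by rw [← mul_assoc, ha, one_mul]
  have hw : b * a * b * a * b = a := by
    have key := congrArg (fun x => a * x) hab
    simpa only [pow_succ, pow_zero, one_mul, mul_one, mul_assoc, ha'] using key
  have hac' : a * (c * (a * (c * (a * (c * (a * (c * (a * c)))))))) = 1 := by
    simpa only [pow_succ, pow_zero, one_mul, mul_assoc] using hac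
  have hca' : c * (a * (c * (a * (c * (a * (c * (a * (c * a)))))))) = 1 := by
    have key := congrArg (fun x => a * x * a) hac'
    simpa only [mul_assoc, ha', mul_one, ha] using key
  constructor
  · calc _ = a * c * (b * a * b * a * b) * c * a * c * a * c * (b * a * b * a * b) * c := by
          simp only [mul_assoc]
      _ = 1 := by rw [hw]; simpa only [mul_assoc] using hac'
  · calc _ = (b * a * b) * (c * a * c) * (b * a * b * a * b) * c * (b * a * b * a * b) *
            (c * a * c) * (b * a) := by simp only [mul_assoc]
      _ = (b * a * b) * (c * a * c * a * c * a * c * a * c) * (b * a) := by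
          rw [hw]; simp only [mul_assoc]
      _ = (b * a * b) * a * (b * a) := by
          have key : c * a * c * a * c * a * c * a * c * a = 1 := by
            simpa only [mul_assoc] using hca'
          rw [eq_inv_of_mul_eq_one_left key, inv_eq_of_mul_eq_one_left ha]
      _ = (b * a * b * a * b) * a := by simp only [mul_assoc]
      _ = 1 := by rw [hw, ha]

/-- The relators of the two presentations vanish on the same triples of group elements. -/
lemma forall_rels18_iff {G : Type*} [Group G] (f : FreeGroup (Fin 3) →* G) :
    (∀ r ∈ rels18, f r = 1) ↔ ∀ r ∈ W35InfRels, f r = 1 := by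
  simp only [rels18, W35InfRels, u, v, Set.mem_insert_iff, Set.mem_singleton_iff,
    forall_eq_or_imp, forall_eq, map_mul, map_inv, map_pow]
  generalize f x1 = a, f x2 = b, f x3 = c
  constructor
  · rintro ⟨ha, h₁, h₂⟩
    have eq_conj {x y z : G} (h : x * y * z * y⁻¹ = 1) : x = y * z⁻¹ * y⁻¹ := by
      rw [mul_assoc, mul_assoc] at h
      rw [eq_inv_of_mul_eq_one_left h]
      group
    have hc : c ^ 2 = 1 := by
      rw [eq_conj h₁, conj_pow, conj_eq_one_iff, inv_pow, inv_eq_one] at ha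
      exact ha
    have hb : b ^ 2 = 1 := by
      rw [eq_conj h₂, conj_pow, inv_pow, hc, inv_one, mul_one, mul_inv_cancel]
    rw [sq] at ha hb hc
    have ia : a⁻¹ = a := inv_eq_of_mul_eq_one_left ha
    have ib : b⁻¹ = b := inv_eq_of_mul_eq_one_left hb
    have ic : c⁻¹ = c := inv_eq_of_mul_eq_one_left hc
    simp only [mul_inv_rev, ia, ib, ic] at h₁ h₂
    simp only [sq, ha, hb, hc, true_and]
    exact coxeter_relations_of_involutions ha hb hc
      (by simpa only [mul_assoc] using h₁) (by simpa only [mul_assoc] using h₂)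
  · rintro ⟨ha, hb, hc, hab, hac⟩
    rw [sq] at ha hb hc
    have ia : a⁻¹ = a := inv_eq_of_mul_eq_one_left ha
    have ib : b⁻¹ = b := inv_eq_of_mul_eq_one_left hb
    have ic : c⁻¹ = c := inv_eq_of_mul_eq_one_left hc
    simpa only [sq, ha, true_and, mul_inv_rev, inv_inv, ia, ib, ic, mul_assoc] using
      relations_of_coxeter ha hab hac

/-- The fundamental group of the Price twist `τ_{R(D₂(12a₄₂₇))}` is isomorphic to the
Coxeter group `W(3,5,∞)`. -/
theorem stmt_18 : Nonempty (PresentedGroup rels18 ≃* PresentedGroup W35InfRels) := by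
  refine ⟨QuotientGroup.quotientMulEquivOfEq (le_antisymm ?_ ?_)⟩
  · exact Subgroup.normalClosure_le_normal fun r hr =>
      PresentedGroup.mk_eq_one_iff.mp ((forall_rels18_iff (PresentedGroup.mk W35InfRels)).mpr
        (fun _ => PresentedGroup.one_of_mem) r hr)
  · exact Subgroup.normalClosure_le_normal fun r hr =>
      PresentedGroup.mk_eq_one_iff.mp ((forall_rels18_iff (PresentedGroup.mk rels18)).mp
        (fun _ => PresentedGroup.one_of_mem) r hr)
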